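/- arXiv:math/0510606 — 2 statements merged into one kernel-verified Lean document; each statement's English description precedes it below -/
import Mathlib

section
/- Fix M > 1 and τ ∈ [0,1]; let c = 2/(1 + M^{−τ}), let J(t) be the rotation matrix with rows (cos t, −sin t) and (sin t, cos t), define for x ≠ 0: K_τ(x) = Id if arg x ∈ [0, cπ/2) ∪ [π, π + cπ/2) and K_τ(x) = diag(M, M^{1−2τ}) otherwise, and set A_τ(x) = J(arg x) K_τ(x) J(arg x)^T, regarded as a coefficient matrix on the unit disk Ω = B₁(0). Define β(A_τ) = ( sup { [ (1/(2πρ)) ∫_{S_ρ(x)} ⟨n, A_τ n⟩/√(det A_τ) dσ ] / [ (4/π) arctan( (ess-inf_{S_ρ(x)} det A_τ / ess-sup_{S_ρ(x)} det A_τ)^{1/4} ) ] : x ∈ Ω, 0 < ρ < dist(x, ∂Ω) } )^{-1}. Then there exists m₀ > 1 such that β(A_τ) = (2/π)(1 + M^{−τ}) arctan M^{−(1−τ)/2} for all M ∈ (1, m₀^{1/τ}) if τ > 0, and with no restriction on M > 1 if τ = 0. -/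
open MeasureTheory Real Set Matrix intervalIntegral
open scoped Classical

noncomputable section

abbrev V2 := EuclideanSpace ℝ (Fin 2)

def toV (v : Fin 2 → ℝ) : V2 := (WithLp.equiv 2 (Fin 2 → ℝ)).symm v

def dot2 (v w : Fin 2 → ℝ) : ℝ := v 0 * w 0 + v 1 * w 1

def quad (A : Matrix (Fin 2) (Fin 2) ℝ) (ξ : Fin 2 → ℝ) : ℝ := dot2 ξ (A.mulVec ξ)

def eit (t : ℝ) : V2 := toV ![Real.cos t, Real.sin t]

/-- The angular polar coordinate `arg y ∈ [0, 2π)` of `y ∈ ℝ²` (with `arg 0 = 0`). -/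
def arg2 (x : V2) : ℝ :=
  if 0 ≤ Complex.arg (Complex.mk (x 0) (x 1)) then Complex.arg (Complex.mk (x 0) (x 1))
  else Complex.arg (Complex.mk (x 0) (x 1)) + 2 * π

/-- The rotation matrix `J(t)`. -/
def Jmat (t : ℝ) : Matrix (Fin 2) (Fin 2) ℝ :=
  !![Real.cos t, -Real.sin t; Real.sin t, Real.cos t]

/-- `c = 2/(1 + M^{−τ})`. -/
def cM (M τ : ℝ) : ℝ := 2 / (1 + M ^ (-τ))

/-- The piecewise-constant matrix `K_τ`: the identity on the cone
`arg x ∈ [0, cπ/2) ∪ [π, π + cπ/2)` and `diag(M, M^{1−2τ})` otherwise. -/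
def Ktau (M τ : ℝ) (x : V2) : Matrix (Fin 2) (Fin 2) ℝ :=
  if arg2 x ∈ Ico 0 (cM M τ * π / 2) ∪ Ico π (π + cM M τ * π / 2) then 1
  else Matrix.diagonal ![M, M ^ (1 - 2 * τ)]

/-- The coefficient matrix `A_τ(x) = J(arg x) K_τ(x) J(arg x)ᵀ`. -/
def Atau (M τ : ℝ) (x : V2) : Matrix (Fin 2) (Fin 2) ℝ :=
  Jmat (arg2 x) * Ktau M τ x * (Jmat (arg2 x))ᵀ

/-- `f(x, ρ) = (1/2π) ∫₀^{2π} ⟨e^{it}, A_τ(x + ρe^{it}) e^{it}⟩ / √(det A_τ(x + ρe^{it})) dt`. -/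
def ftau (M τ : ℝ) (x : V2) (ρ : ℝ) : ℝ :=
  (1 / (2 * π)) * ∫ t in (0 : ℝ)..(2 * π),
    quad (Atau M τ (x + ρ • eit t)) (eit t) / Real.sqrt ((Atau M τ (x + ρ • eit t)).det)

/-- The quotient, over the circle `S_ρ(x)` parametrized by `t ↦ x + ρe^{it}`, of the
mean value `(1/(2πρ)) ∫_{S_ρ(x)} ⟨n, An⟩/√(det A) dσ` by
`(4/π) arctan((essinf det A / esssup det A)^{1/4})`. -/
def circQuot (A : V2 → Matrix (Fin 2) (Fin 2) ℝ) (x : V2) (ρ : ℝ) : ℝ :=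
  ((1 / (2 * π * ρ)) *
      ∫ t in (0 : ℝ)..(2 * π),
        (quad (A (x + ρ • eit t)) (eit t) / Real.sqrt ((A (x + ρ • eit t)).det)) * ρ) /
    ((4 / π) * arctan
      ((essInf (fun t => (A (x + ρ • eit t)).det) (volume.restrict (Ioc 0 (2 * π))) /
          essSup (fun t => (A (x + ρ • eit t)).det) (volume.restrict (Ioc 0 (2 * π)))) ^
        ((1 : ℝ) / 4)))

/-- The Hölder exponent bound `β(A)` on the domain `Ω`. -/
def betaA (Ω : Set V2) (A : V2 → Matrix (Fin 2) (Fin 2) ℝ) : ℝ :=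
  (sSup {r : ℝ | ∃ x ∈ Ω, ∃ ρ : ℝ, 0 < ρ ∧ ρ < Metric.infDist x Ωᶜ ∧ r = circQuot A x ρ})⁻¹

theorem integral_comp_exp_eq {F : ℂ → ℂ} (hF : DiffContOnCl ℂ F (Metric.ball 0 1)) :
    ∫ t in (0 : ℝ)..(2 * π), F (Complex.exp (t * Complex.I)) = 2 * π * F 0 := by
  have h := DiffContOnCl.circleAverage (c := 0) (R := 1) (f := F) (by simpa using hF)
  rw [Real.circleAverage_def, inv_smul_eq_iff₀ (by positivity)] at h
  simpa [circleMap] using h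

theorem integral_exp_int_mul {B : ℂ → ℂ} (hB : DiffContOnCl ℂ B (Metric.ball 0 1))
    (hB0 : B 0 = 0) {s : ℝ → ℝ}
    (hs : ∀ t, Complex.exp (s t * Complex.I) = B (Complex.exp (t * Complex.I)))
    {n : ℤ} (hn : n ≠ 0) :
    ∫ t in (0 : ℝ)..(2 * π), Complex.exp (n * s t * Complex.I) = 0 := by
  have hpow : ∀ m : ℕ, m ≠ 0 →
      ∫ t in (0 : ℝ)..(2 * π), Complex.exp (m * s t * Complex.I) = 0 := by
    intro m hm
    have hd : DiffContOnCl ℂ (fun z => B z ^ m) (Metric.ball 0 1) :=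
      ⟨hB.differentiableOn.pow m, hB.continuousOn.pow m⟩
    have h := integral_comp_exp_eq hd
    simp only [hB0, ← hs, ← Complex.exp_nat_mul] at h
    simpa [hm, mul_assoc] using h
  obtain ⟨m, rfl | rfl⟩ := n.eq_nat_or_neg
  · exact hpow m (by simpa using hn)
  · have h := congrArg (starRingEnd ℂ) (hpow m (by simpa using hn))
    rw [intervalIntegral.integral_of_le (by positivity), ← integral_conj] at h
    rw [intervalIntegral.integral_of_le (by positivity)]
    simpa [← Complex.exp_conj] using h

instance : Fact ((0 : ℝ) < 2 * π) := ⟨by positivity⟩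

theorem continuous_integral_continuousMap {X : Type*} [TopologicalSpace X] [CompactSpace X]
    [MeasurableSpace X] [BorelSpace X] [SecondCountableTopologyEither X ℂ]
    (μ : Measure X) [IsFiniteMeasure μ] :
    Continuous fun f : C(X, ℂ) => ∫ x, f x ∂μ := by
  have := (MeasureTheory.continuous_integral (μ := μ) (G := ℂ) ).comp (ContinuousMap.toLp (E := ℂ) 1 μ ℂ).continuous
  refine this.congr fun f => ?_
  exact integral_congr_ae (ContinuousMap.coeFn_toLp μ f)

theorem AddCircle.measure_ext_of_fourier {T : ℝ} [hT : Fact (0 < T)]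
    {μ ν : Measure (AddCircle T)} [IsFiniteMeasure μ] [IsFiniteMeasure ν]
    (h : ∀ n : ℤ, ∫ x, fourier n x ∂μ = ∫ x, fourier n x ∂ν) : μ = ν := by
  have hint : ∀ (κ : Measure (AddCircle T)) [IsFiniteMeasure κ] (f : C(AddCircle T, ℂ)),
      Integrable f κ := fun κ _ f =>
    BoundedContinuousFunction.integrable κ (BoundedContinuousFunction.mkOfCompact f)
  have key : ∀ f : C(AddCircle T, ℂ), ∫ x, f x ∂μ = ∫ x, f x ∂ν := by
    intro f
    have hf : f ∈ (Submodule.span ℂ (range (@fourier T))).topologicalClosure := by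
      rw [span_fourier_closure_eq_top]; trivial
    have hcl : IsClosed {f : C(AddCircle T, ℂ) | ∫ x, f x ∂μ = ∫ x, f x ∂ν} :=
      isClosed_eq (continuous_integral_continuousMap μ) (continuous_integral_continuousMap ν)
    refine closure_minimal (fun g hg => ?_) hcl hf
    induction hg using Submodule.span_induction with
    | mem g hg => obtain ⟨n, rfl⟩ := hg; exact h n
    | zero => simp
    | add a b _ _ ha hb =>
      simp only [mem_ofPred_eq, ContinuousMap.add_apply] at *
      rw [integral_add (hint μ a) (hint μ b), integral_add (hint ν a) (hint ν b), ha, hb]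
    | smul c a _ ha =>
      simp only [mem_ofPred_eq, ContinuousMap.smul_apply] at *
      rw [MeasureTheory.integral_smul, MeasureTheory.integral_smul, ha]
  refine ext_of_forall_integral_eq_of_IsFiniteMeasure fun f => ?_
  have h1 := key ⟨fun x => (f x : ℂ), by fun_prop⟩
  simp only [ContinuousMap.coe_mk] at h1
  rw [integral_complex_ofReal, integral_complex_ofReal] at h1
  exact_mod_cast h1

theorem map_coe_angle_eq_volume {B : ℂ → ℂ} (hB : DiffContOnCl ℂ B (Metric.ball 0 1))
    (hB0 : B 0 = 0) {s : ℝ → ℝ} (hm : Measurable s)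
    (hs : ∀ t, Complex.exp (s t * Complex.I) = B (Complex.exp (t * Complex.I))) :
    Measure.map (fun t => (s t : AddCircle (2 * π))) (volume.restrict (Ioc 0 (2 * π))) =
      volume := by
  have hfour : ∀ {B : ℂ → ℂ}, DiffContOnCl ℂ B (Metric.ball 0 1) → B 0 = 0 →
      ∀ {s : ℝ → ℝ}, Measurable s →
      (∀ t, Complex.exp (s t * Complex.I) = B (Complex.exp (t * Complex.I))) → ∀ n : ℤ,
      ∫ x, fourier n x ∂(Measure.map (fun t => (s t : AddCircle (2 * π)))
        (volume.restrict (Ioc 0 (2 * π)))) = if n = 0 then (2 * π : ℂ) else 0 := by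
    intro B hB hB0 s hm hs n
    have hms : Measurable fun t => (s t : AddCircle (2 * π)) := AddCircle.measurable_mk'.comp hm
    rw [integral_map hms.aemeasurable
      (fourier n).continuous.aestronglyMeasurable,
      ← intervalIntegral.integral_of_le (by positivity)]
    have hpt : ∀ t, fourier n (s t : AddCircle (2 * π)) =
        Complex.exp (n * s t * Complex.I) := by
      intro t
      rw [fourier_coe_apply]
      congr 1
      have : (π : ℂ) ≠ 0 := by exact_mod_cast Real.pi_ne_zero
      push_cast
      field_simp
    simp only [hpt]
    split_ifs with hn
    · simp [hn]
    · exact integral_exp_int_mul hB hB0 hs hn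
  have hid := (AddCircle.measurePreserving_mk (2 * π) 0).map_eq
  rw [zero_add] at hid
  rw [← hid]
  refine AddCircle.measure_ext_of_fourier fun n => ?_
  rw [hfour hB hB0 hm hs n]
  exact (hfour (B := id) (s := id) ⟨differentiableOn_id, continuousOn_id⟩ rfl measurable_id
    (fun t => rfl) n).symm

/-- The point of `ℂ` with the same coordinates as `y`. -/
def toComplex (y : V2) : ℂ := ⟨y 0, y 1⟩

/-- The double cone `arg y ∈ [0, cπ/2) ∪ [π, π + cπ/2)` of the plane. -/
def InCone (c : ℝ) (y : V2) : Prop :=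
  arg2 y ∈ Ico 0 (c * π / 2) ∪ Ico π (π + c * π / 2)

theorem toComplex_add_smul_eit (x : V2) (ρ t : ℝ) :
    toComplex (x + ρ • eit t) = toComplex x + ρ * Complex.exp (t * Complex.I) := by
  rw [Complex.exp_mul_I]
  apply Complex.ext <;>
    simp [toComplex, eit, toV, ← Complex.ofReal_cos, ← Complex.ofReal_sin]

theorem arg2_nonneg (y : V2) : 0 ≤ arg2 y := by
  unfold arg2
  split_ifs with h
  · exact h
  · linarith [Complex.neg_pi_lt_arg ⟨y 0, y 1⟩, Real.pi_pos]

theorem arg2_lt_two_pi (y : V2) : arg2 y < 2 * π := by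
  unfold arg2
  split_ifs with h
  · linarith [Complex.arg_le_pi ⟨y 0, y 1⟩, Real.pi_pos]
  · linarith

theorem norm_mul_exp_arg2 (y : V2) :
    ‖toComplex y‖ * Complex.exp (arg2 y * Complex.I) = toComplex y := by
  have h := Complex.norm_mul_exp_arg_mul_I (toComplex y)
  have he : Complex.exp (arg2 y * Complex.I) =
      Complex.exp (Complex.arg (toComplex y) * Complex.I) := by
    unfold arg2 toComplex
    split_ifs
    · rfl
    · push_cast
      rw [add_mul, Complex.exp_add, Complex.exp_two_pi_mul_I, mul_one]
  rw [he, h]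

theorem exp_two_mul_arg2_mul_conj (y : V2) :
    Complex.exp ((2 * arg2 y : ℝ) * Complex.I) * starRingEnd ℂ (toComplex y) = toComplex y := by
  have h := norm_mul_exp_arg2 y
  set θ := arg2 y
  set r := ‖toComplex y‖
  rw [← h, map_mul, Complex.conj_ofReal, ← Complex.exp_conj, mul_left_comm, ← Complex.exp_add]
  congr 2
  simp
  ring

theorem measurable_arg2 : Measurable arg2 := by
  have h : Measurable fun y : V2 => Complex.arg ⟨y 0, y 1⟩ := by
    have : Continuous fun y : V2 => (⟨y 0, y 1⟩ : ℂ) := by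
      have : (fun y : V2 => (⟨y 0, y 1⟩ : ℂ)) = fun y : V2 => (y 0 : ℂ) + y 1 * Complex.I := by
        ext y
        exact Complex.mk_eq_add_mul_I _ _
      rw [this]
      fun_prop
    exact Complex.measurable_arg.comp this.measurable
  exact Measurable.ite (measurableSet_le measurable_const h) h (h.add_const _)

theorem measurable_arg2_circle (x : V2) (ρ : ℝ) :
    Measurable fun t => arg2 (x + ρ • eit t) := by
  have : Continuous fun t : ℝ => x + ρ • eit t := by
    have : Continuous eit := by
      unfold eit toV
      refine (PiLp.continuous_toLp 2 _).comp (continuous_pi fun i => ?_)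
      fin_cases i
      · exact Real.continuous_cos
      · exact Real.continuous_sin
    fun_prop
  exact measurable_arg2.comp this.measurable

theorem inCone_iff {c : ℝ} (hc : c < 2) (y : V2) :
    InCone c y ↔
      (AddCircle.equivIco (2 * π) 0 ((2 * arg2 y : ℝ) : AddCircle (2 * π)) : ℝ) < c * π := by
  have h0 := arg2_nonneg y
  have h1 := arg2_lt_two_pi y
  have hp := Real.pi_pos
  rw [AddCircle.coe_equivIco_mk_apply, mul_div_mul_left _ _ (two_ne_zero)]
  unfold InCone
  set θ := arg2 y
  simp only [mem_union, mem_Ico]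
  have hcp : c * π < 2 * π := by gcongr
  by_cases hθ : θ < π
  · have : Int.fract (θ / π) = θ / π :=
      Int.fract_eq_self.2 ⟨by positivity, (div_lt_one hp).2 hθ⟩
    rw [this, show θ / π * (2 * π) = 2 * θ by field_simp]
    constructor
    · rintro (h | h) <;> linarith
    · intro h
      left
      constructor <;> linarith
  · push Not at hθ
    have : Int.fract (θ / π) = θ / π - 1 := by
      rw [Int.fract_eq_iff]
      refine ⟨by rw [sub_nonneg, one_le_div hp]; exact hθ, ?_, 1, by simp⟩
      rw [sub_lt_iff_lt_add, div_lt_iff₀ hp]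
      linarith
    rw [this, show (θ / π - 1) * (2 * π) = 2 * θ - 2 * π by field_simp]
    constructor
    · rintro (h | h) <;> linarith
    · intro h
      right
      constructor <;> linarith

theorem volume_inCone_circle {x : V2} {ρ c : ℝ} (hx : ‖toComplex x‖ < ρ) (hc0 : 0 ≤ c)
    (hc : c < 2) :
    (volume.restrict (Ioc 0 (2 * π))).real {t | InCone c (x + ρ • eit t)} = c * π := by
  set X := toComplex x
  have hρ : 0 < ρ := (norm_nonneg _).trans_lt hx
  have hden : ∀ z ∈ Metric.closedBall (0 : ℂ) 1, starRingEnd ℂ X * z + ρ ≠ 0 := by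
    intro z hz h
    have hz : ‖z‖ ≤ 1 := by simpa using hz
    have h1 : ‖starRingEnd ℂ X * z‖ = ρ := by
      rw [eq_neg_of_add_eq_zero_left h]; simp [abs_of_pos hρ]
    rw [norm_mul, RCLike.norm_conj] at h1
    nlinarith [norm_nonneg X]
  set B : ℂ → ℂ := fun z => z * (ρ * z + X) / (starRingEnd ℂ X * z + ρ) with hBdef
  have hB : DiffContOnCl ℂ B (Metric.ball 0 1) := by
    refine DifferentiableOn.diffContOnCl ?_
    rw [closure_ball _ one_ne_zero]
    exact DifferentiableOn.div (by fun_prop) (by fun_prop) hden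
  have hs : ∀ t : ℝ, Complex.exp ((2 * arg2 (x + ρ • eit t) : ℝ) * Complex.I) =
      B (Complex.exp (t * Complex.I)) := by
    intro t
    have h := exp_two_mul_arg2_mul_conj (x + ρ • eit t)
    rw [toComplex_add_smul_eit] at h
    set z := Complex.exp (t * Complex.I) with hz
    have hzz : starRingEnd ℂ z * z = 1 := by
      rw [hz, ← Complex.exp_conj, ← Complex.exp_add]; simp
    have hzn : z ∈ Metric.closedBall (0 : ℂ) 1 := by simp [hz]
    rw [hBdef, eq_div_iff (hden z hzn)]
    simp only [map_add, map_mul, Complex.conj_ofReal] at h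
    linear_combination z * h - Complex.exp ((2 * arg2 (x + ρ • eit t) : ℝ) * Complex.I) * ρ * hzz
  have hm : Measurable fun t => 2 * arg2 (x + ρ • eit t) :=
    (measurable_arg2_circle x ρ).const_mul 2
  have hmap := map_coe_angle_eq_volume hB (by simp [hBdef]) hm hs
  have hS : MeasurableSet {a : AddCircle (2 * π) | (AddCircle.equivIco (2 * π) 0 a : ℝ) < c * π} :=
    measurableSet_lt
      (measurable_subtype_coe.comp (AddCircle.measurableEquivIco (2 * π) 0).measurable)
      measurable_const
  have hset : {t | InCone c (x + ρ • eit t)} =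
      (fun t => ((2 * arg2 (x + ρ • eit t) : ℝ) : AddCircle (2 * π))) ⁻¹'
        {a : AddCircle (2 * π) | (AddCircle.equivIco (2 * π) 0 a : ℝ) < c * π} := by
    ext t
    exact inCone_iff hc _
  have hvol := AddCircle.add_projection_respects_measure (2 * π) 0 hS
  have hms : Measurable fun t => ((2 * arg2 (x + ρ • eit t) : ℝ) : AddCircle (2 * π)) :=
    AddCircle.measurable_mk'.comp hm
  rw [Measure.real, hset, ← Measure.map_apply hms hS, hmap, hvol]
  have hp := Real.pi_pos
  have hcp : c * π < 2 * π := by gcongr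
  have hae : ((QuotientAddGroup.mk ⁻¹' {a : AddCircle (2 * π) |
      (AddCircle.equivIco (2 * π) 0 a : ℝ) < c * π} ∩ Ioc 0 (0 + 2 * π) : Set ℝ)) =ᵐ[volume]
      Ioo 0 (c * π) := by
    have hne : ∀ᵐ t : ℝ, t ≠ 2 * π := by simp [ae_iff]
    filter_upwards [hne] with t ht
    apply propext
    change (_ ∧ t ∈ Ioc 0 (0 + 2 * π)) ↔ t ∈ Ioo 0 (c * π)
    simp only [mem_preimage, mem_ofPred_eq, AddCircle.coe_equivIco_mk_apply, mem_Ioc, mem_Ioo,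
      zero_add]
    have hfr : 0 < t → t < 2 * π → Int.fract (t / (2 * π)) * (2 * π) = t := by
      intro h1 h2
      rw [Int.fract_eq_self.2 ⟨by positivity, (div_lt_one (by positivity)).2 h2⟩]
      field_simp
    constructor
    · rintro ⟨h, h1, h2⟩
      rw [hfr h1 (lt_of_le_of_ne h2 ht)] at h
      exact ⟨h1, h⟩
    · rintro ⟨h1, h2⟩
      rw [hfr h1 (by linarith)]
      exact ⟨h2, h1, by linarith⟩
  rw [measure_congr hae, Real.volume_Ioo, sub_zero, ENNReal.toReal_ofReal (by positivity)]

theorem exists_diffContOnCl_exp_arg2 {x : V2} {ρ : ℝ} (hρ : 0 < ρ) (hx : ρ ≤ ‖toComplex x‖) :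
    ∃ w : ℂ → ℂ, DiffContOnCl ℂ w (Metric.ball 0 1) ∧ w 0 = 0 ∧ ∀ t : ℝ,
      ‖w (Complex.exp (t * Complex.I))‖ = 1 ∧
      (toComplex (x + ρ • eit t) ≠ 0 →
        Complex.exp ((2 * (t - arg2 (x + ρ • eit t)) : ℝ) * Complex.I) =
          w (Complex.exp (t * Complex.I))) := by
  set X := toComplex x
  have hexp : ∀ t : ℝ, toComplex (x + ρ • eit t) ≠ 0 →
      Complex.exp ((2 * (t - arg2 (x + ρ • eit t)) : ℝ) * Complex.I) =
        Complex.exp (t * Complex.I) * (starRingEnd ℂ X * Complex.exp (t * Complex.I) + ρ) /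
          (X + ρ * Complex.exp (t * Complex.I)) := by
    intro t hne
    have h := exp_two_mul_arg2_mul_conj (x + ρ • eit t)
    rw [toComplex_add_smul_eit] at h hne
    have hsplit : Complex.exp ((2 * (t - arg2 (x + ρ • eit t)) : ℝ) * Complex.I) *
        Complex.exp ((2 * arg2 (x + ρ • eit t) : ℝ) * Complex.I) =
        Complex.exp (t * Complex.I) * Complex.exp (t * Complex.I) := by
      rw [← Complex.exp_add, ← Complex.exp_add]
      congr 1
      push_cast
      ring
    set z := Complex.exp (t * Complex.I) with hz
    have hzz : starRingEnd ℂ z * z = 1 := by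
      rw [hz, ← Complex.exp_conj, ← Complex.exp_add]; simp
    rw [eq_div_iff hne]
    simp only [map_add, map_mul, Complex.conj_ofReal] at h
    linear_combination (-Complex.exp ((2 * (t - arg2 (x + ρ • eit t)) : ℝ) * Complex.I)) * h
      + (starRingEnd ℂ X + ρ * starRingEnd ℂ z) * hsplit + ρ * z * hzz
  rcases hx.lt_or_eq with hlt | heq
  · have hden : ∀ z ∈ Metric.closedBall (0 : ℂ) 1, X + ρ * z ≠ 0 := by
      intro z hz h
      have hz : ‖z‖ ≤ 1 := by simpa using hz
      have h1 : ‖X‖ = ρ * ‖z‖ := by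
        rw [eq_neg_of_add_eq_zero_left h]; simp [abs_of_pos hρ]
      nlinarith
    refine ⟨fun z => z * (starRingEnd ℂ X * z + ρ) / (X + ρ * z), ?_, by simp, fun t => ?_⟩
    · refine DifferentiableOn.diffContOnCl ?_
      rw [closure_ball _ one_ne_zero]
      exact DifferentiableOn.div (by fun_prop) (by fun_prop) hden
    · have hne : toComplex (x + ρ • eit t) ≠ 0 := by
        rw [toComplex_add_smul_eit]
        exact hden _ (by simp)
      refine ⟨?_, fun _ => hexp t hne⟩
      beta_reduce
      rw [← hexp t hne, Complex.norm_exp_ofReal_mul_I]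
  · have hρ' : (ρ : ℂ) ≠ 0 := by exact_mod_cast hρ.ne'
    refine ⟨fun z => z * (starRingEnd ℂ X / ρ), ?_, by simp, fun t => ⟨?_, fun hne => ?_⟩⟩
    · exact (Differentiable.diffContOnCl (by fun_prop))
    · rw [norm_mul, Complex.norm_exp_ofReal_mul_I, norm_div, RCLike.norm_conj, ← heq]
      simp [abs_of_pos hρ, hρ.ne']
    · rw [hexp t hne]
      rw [toComplex_add_smul_eit] at hne
      have hXX : starRingEnd ℂ X * X = ρ * ρ := by
        rw [Complex.conj_mul', ← heq]; ring
      change _ = Complex.exp (t * Complex.I) * (starRingEnd ℂ X / ρ)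
      rw [div_eq_iff hne]
      field_simp
      linear_combination -hXX

/-- The integrand on the circle around `x`: `1` in the double cone, and
`L cos² φ + L⁻¹ sin² φ` outside, where `φ` is the angle between `y` and the normal. -/
def coneProfile (L c : ℝ) (y : V2) (t : ℝ) : ℝ :=
  if InCone c y then 1
  else L * Real.cos (t - arg2 y) ^ 2 + L⁻¹ * Real.sin (t - arg2 y) ^ 2

theorem coneProfile_nonneg {L c : ℝ} (hL : 1 ≤ L) (y : V2) (t : ℝ) :
    0 ≤ coneProfile L c y t := by
  unfold coneProfile
  split_ifs <;> positivity

theorem measurableSet_inCone_circle (c : ℝ) (x : V2) (ρ : ℝ) :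
    MeasurableSet {t | InCone c (x + ρ • eit t)} :=
  measurable_arg2_circle x ρ (measurableSet_Ico.union measurableSet_Ico)

theorem integral_ite_inCone_circle {x : V2} {ρ c : ℝ} (hx : ‖toComplex x‖ < ρ) (hc0 : 0 ≤ c)
    (hc : c < 2) (L : ℝ) :
    Integrable (fun t => if InCone c (x + ρ • eit t) then (1 : ℝ) else L)
      (volume.restrict (Ioc 0 (2 * π))) ∧
    ∫ t in Ioc 0 (2 * π), (if InCone c (x + ρ • eit t) then (1 : ℝ) else L) =
      c * π + (2 - c) * π * L := by
  have hms := measurableSet_inCone_circle c x ρ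
  have hfun : (fun t => if InCone c (x + ρ • eit t) then (1 : ℝ) else L) =
      fun t => L + (1 - L) * indicator {t | InCone c (x + ρ • eit t)} 1 t := by
    ext t
    by_cases h : InCone c (x + ρ • eit t) <;> simp [indicator, h]
  have hi : Integrable (indicator {t | InCone c (x + ρ • eit t)} (1 : ℝ → ℝ))
      (volume.restrict (Ioc 0 (2 * π))) := (integrable_const (1 : ℝ)).indicator hms
  rw [hfun]
  refine ⟨(integrable_const _).add (hi.const_mul _), ?_⟩
  rw [integral_add (integrable_const _) (hi.const_mul _), MeasureTheory.integral_const_mul,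
    integral_indicator_one hms, volume_inCone_circle hx hc0 hc]
  simp [Real.pi_pos.le]
  ring

theorem integral_coneProfile_le_of_lt {x : V2} {ρ c L : ℝ} (hx : ‖toComplex x‖ < ρ)
    (hc0 : 0 ≤ c) (hc : c < 2) (hL : 1 ≤ L) :
    ∫ t in Ioc 0 (2 * π), coneProfile L c (x + ρ • eit t) t ≤ c * π + (2 - c) * π * L := by
  obtain ⟨hi, he⟩ := integral_ite_inCone_circle hx hc0 hc L
  rw [← he]
  refine integral_mono_of_nonneg (.of_forall fun t => coneProfile_nonneg hL _ t) hi
    (.of_forall fun t => ?_)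
  simp only [coneProfile]
  split_ifs
  · rfl
  · have h1 := Real.sin_sq_add_cos_sq (t - arg2 (x + ρ • eit t))
    have h2 : L⁻¹ ≤ L := (inv_le_one_of_one_le₀ hL).trans hL
    have h3 := sq_nonneg (Real.sin (t - arg2 (x + ρ • eit t)))
    nlinarith

theorem coneProfile_le {L c : ℝ} (hL : 1 ≤ L) {y : V2} {t : ℝ} {w : ℂ} (hw : ‖w‖ = 1)
    (hy : toComplex y ≠ 0 → Complex.exp ((2 * (t - arg2 y) : ℝ) * Complex.I) = w)
    (hc : 0 < c) :
    coneProfile L c y t ≤ (L + L⁻¹) / 2 + (L - L⁻¹) / 2 * (3 / 8 + w / 2 + w ^ 2 / 8 : ℂ).re := by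
  have hre : (3 / 8 + w / 2 + w ^ 2 / 8 : ℂ).re = (1 + w.re) ^ 2 / 4 := by
    have h : w.re * w.re + w.im * w.im = 1 := by
      rw [← Complex.normSq_apply, Complex.normSq_eq_norm_sq, hw, one_pow]
    have e1 : (3 / 8 : ℂ).re = 3 / 8 := by norm_num
    have e2 : (w / 2).re = w.re / 2 := by simp
    have e3 : (w ^ 2 / 8).re = (w ^ 2).re / 8 := by simp
    rw [Complex.add_re, Complex.add_re, e1, e2, e3, pow_two w, Complex.mul_re]
    linarith
  have hinv : L⁻¹ ≤ L := (inv_le_one_of_one_le₀ hL).trans hL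
  have hsum : 2 ≤ L + L⁻¹ := by
    have : L * L⁻¹ = 1 := mul_inv_cancel₀ (by positivity)
    nlinarith [sq_nonneg (L - L⁻¹), inv_nonneg.2 (zero_le_one.trans hL)]
  rw [hre]
  unfold coneProfile
  split_ifs with h
  · have : 0 ≤ (L - L⁻¹) / 2 * ((1 + w.re) ^ 2 / 4) :=
      mul_nonneg (by linarith) (by positivity)
    linarith
  · have hne : toComplex y ≠ 0 := by
      intro h0
      refine h (Or.inl ?_)
      have : arg2 y = 0 := by
        have h0' : (⟨y 0, y 1⟩ : ℂ) = 0 := h0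
        simp [arg2, h0']
      rw [this]
      exact ⟨le_rfl, by positivity⟩
    have hwre : w.re = Real.cos (2 * (t - arg2 y)) := by
      rw [← hy hne, Complex.exp_ofReal_mul_I_re]
    have hcos := Real.cos_sq (t - arg2 y)
    have hsin := Real.sin_sq_add_cos_sq (t - arg2 y)
    rw [hwre, hcos, show Real.sin (t - arg2 y) ^ 2 = 1 / 2 - Real.cos (2 * (t - arg2 y)) / 2 by
      linarith]
    nlinarith [mul_nonneg (sub_nonneg.2 hinv) (sq_nonneg (Real.cos (2 * (t - arg2 y)) - 1))]

theorem integral_coneProfile_le_of_le {x : V2} {ρ c L : ℝ} (hρ : 0 < ρ)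
    (hx : ρ ≤ ‖toComplex x‖) (hc : 0 < c) (hL : 1 ≤ L) :
    ∫ t in Ioc 0 (2 * π), coneProfile L c (x + ρ • eit t) t ≤
      2 * π * ((L + L⁻¹) / 2 + (L - L⁻¹) / 2 * (3 / 8)) := by
  obtain ⟨w, hw, hw0, hwt⟩ := exists_diffContOnCl_exp_arg2 hρ hx
  set F : ℂ → ℂ := fun z => 3 / 8 + w z / 2 + w z ^ 2 / 8 with hF
  have hFd : DiffContOnCl ℂ F (Metric.ball 0 1) := by
    have h1 := hw.differentiableOn
    have h2 := hw.continuousOn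
    exact ⟨by fun_prop, by fun_prop⟩
  have hmean := integral_comp_exp_eq hFd
  have hFi : Integrable (fun t : ℝ => F (Complex.exp (t * Complex.I)))
      (volume.restrict (Ioc 0 (2 * π))) := by
    have : Continuous fun t : ℝ => F (Complex.exp (t * Complex.I)) := by
      refine hFd.continuousOn.comp_continuous (by fun_prop) fun t => ?_
      rw [closure_ball _ one_ne_zero]
      simp
    exact (this.intervalIntegrable 0 (2 * π)).1
  rw [intervalIntegral.integral_of_le (by positivity)] at hmean
  have hre : ∫ t in Ioc 0 (2 * π), (F (Complex.exp (t * Complex.I))).re = 2 * π * (3 / 8) := by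
    have h := integral_re hFi
    simp only [RCLike.re_eq_complex_re] at h
    rw [h, hmean, hF]
    simp [hw0]
  have hFre : Integrable (fun t : ℝ => (F (Complex.exp (t * Complex.I))).re)
      (volume.restrict (Ioc 0 (2 * π))) := hFi.re
  have hbound : Integrable (fun t : ℝ => (L + L⁻¹) / 2 + (L - L⁻¹) / 2 *
      (F (Complex.exp (t * Complex.I))).re) (volume.restrict (Ioc 0 (2 * π))) :=
    (integrable_const _).add (hFre.const_mul _)
  refine (integral_mono_of_nonneg (.of_forall fun t => coneProfile_nonneg hL _ t) hbound
    (.of_forall fun t => coneProfile_le hL (hwt t).1 (hwt t).2 hc)).trans_eq ?_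
  rw [integral_add (integrable_const _) (hFre.const_mul _), MeasureTheory.integral_const_mul, hre]
  simp [Real.pi_pos.le]
  ring

theorem integral_coneProfile_le {x : V2} {ρ L : ℝ} (hρ : 0 < ρ) (hL : 1 ≤ L) (hL' : L ≤ 5 / 4) :
    ∫ t in Ioc 0 (2 * π), coneProfile L (2 / (1 + L⁻¹)) (x + ρ • eit t) t ≤
      2 * π * (2 / (1 + L⁻¹)) := by
  have hL0 : 0 < L := by linarith
  have hc : 2 / (1 + L⁻¹) = 2 * L / (L + 1) := by field_simp
  rw [hc]
  have hc2 : 2 * L / (L + 1) < 2 := by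
    rw [div_lt_iff₀ (by positivity)]
    linarith
  rcases lt_or_ge ‖toComplex x‖ ρ with h | h
  · refine (integral_coneProfile_le_of_lt h (by positivity) hc2 hL).trans_eq ?_
    field_simp
    ring
  · refine (integral_coneProfile_le_of_le hρ h (by positivity) hL).trans ?_
    gcongr
    rw [le_div_iff₀ (by positivity)]
    have : L * L⁻¹ = 1 := mul_inv_cancel₀ hL0.ne'
    have h2 : ((L + L⁻¹) / 2 + (L - L⁻¹) / 2 * (3 / 8)) * (L + 1) =
        ((L ^ 2 + 1) / 2 + (L ^ 2 - 1) / 2 * (3 / 8)) * (L + 1) / L := by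
      field_simp
    rw [h2, div_le_iff₀ hL0]
    nlinarith [mul_nonneg (sub_nonneg.2 hL) (sub_nonneg.2 hL')]

theorem Ktau_eq_ite (M τ : ℝ) (y : V2) :
    Ktau M τ y = if InCone (cM M τ) y then 1 else Matrix.diagonal ![M, M ^ (1 - 2 * τ)] := by
  unfold Ktau InCone
  congr

theorem det_Atau {M : ℝ} (hM : 0 < M) (τ : ℝ) (y : V2) :
    (Atau M τ y).det = if InCone (cM M τ) y then 1 else M ^ (2 - 2 * τ) := by
  have hJ : (Jmat (arg2 y)).det = 1 := by
    rw [Jmat, det_fin_two_of]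
    nlinarith [Real.sin_sq_add_cos_sq (arg2 y)]
  rw [Atau, det_mul, det_mul, det_transpose, hJ, Ktau_eq_ite]
  split_ifs
  · simp
  · simp only [det_diagonal, Fin.prod_univ_two, cons_val_zero, cons_val_one, one_mul, mul_one]
    rw [show (2 : ℝ) - 2 * τ = 1 + (1 - 2 * τ) by ring, Real.rpow_add hM, Real.rpow_one]

theorem quad_Atau_div_sqrt_det {M : ℝ} (hM : 0 < M) (τ : ℝ) (y : V2) (t : ℝ) :
    quad (Atau M τ y) (eit t) / Real.sqrt (Atau M τ y).det =
      coneProfile (M ^ τ) (cM M τ) y t := by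
  rw [det_Atau hM, Atau, Ktau_eq_ite]
  unfold coneProfile
  split_ifs
  · rw [Real.sqrt_one, div_one, mul_one]
    simp [quad, dot2, eit, toV, Jmat, mulVec, dotProduct, Fin.sum_univ_two, Matrix.mul_apply]
    linear_combination (Real.cos t ^ 2 + Real.sin t ^ 2) * Real.sin_sq_add_cos_sq (arg2 y)
      + Real.sin_sq_add_cos_sq t
  · have hsq : Real.sqrt (M ^ (2 - 2 * τ)) = M ^ (1 - τ) := by
      rw [Real.sqrt_eq_rpow, ← Real.rpow_mul hM.le]
      congr 1
      ring
    have h1 : M = M ^ τ * M ^ (1 - τ) := by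
      rw [← Real.rpow_add hM]; simp
    have h2 : M ^ (1 - 2 * τ) = (M ^ τ)⁻¹ * M ^ (1 - τ) := by
      rw [← Real.rpow_neg hM.le, ← Real.rpow_add hM]
      congr 1
      ring
    have hpos : 0 < M ^ (1 - τ) := Real.rpow_pos_of_pos hM _
    have hquad : ∀ a b : ℝ, quad (Jmat (arg2 y) * Matrix.diagonal ![a, b] * (Jmat (arg2 y))ᵀ)
        (eit t) = a * Real.cos (t - arg2 y) ^ 2 + b * Real.sin (t - arg2 y) ^ 2 := by
      intro a b
      rw [Real.cos_sub, Real.sin_sub]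
      simp [quad, dot2, eit, toV, Jmat, mulVec, dotProduct, Fin.sum_univ_two, Matrix.mul_apply,
        Matrix.vecMul_diagonal]
      ring
    rw [hquad, hsq, h2, div_eq_iff hpos.ne']
    linear_combination Real.cos (t - arg2 y) ^ 2 * h1

section EssBounds

variable {α : Type*} [MeasurableSpace α] {ν : Measure α} {h : α → ℝ} {a b : ℝ}

theorem isBoundedUnder_le_of_forall_le (hb : ∀ t, h t ≤ b) :
    Filter.IsBoundedUnder (· ≤ ·) (ae ν) h :=
  Filter.isBoundedUnder_of ⟨b, hb⟩

theorem isBoundedUnder_ge_of_forall_le (ha : ∀ t, a ≤ h t) :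
    Filter.IsBoundedUnder (· ≥ ·) (ae ν) h :=
  Filter.isBoundedUnder_of ⟨a, ha⟩

theorem le_essInf_of_forall_le [NeZero ν] (ha : ∀ t, a ≤ h t) (hb : ∀ t, h t ≤ b) :
    a ≤ essInf h ν :=
  le_essInf_of_ae_le a (.of_forall ha)
    (isBoundedUnder_le_of_forall_le hb).isCoboundedUnder_ge

theorem essSup_le_of_forall_le [NeZero ν] (ha : ∀ t, a ≤ h t) (hb : ∀ t, h t ≤ b) :
    essSup h ν ≤ b :=
  essSup_le_of_ae_le b (.of_forall hb)
    (isBoundedUnder_ge_of_forall_le ha).isCoboundedUnder_le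

theorem le_essSup_of_forall_le [NeZero ν] (ha : ∀ t, a ≤ h t) (hb : ∀ t, h t ≤ b) :
    a ≤ essSup h ν :=
  Filter.le_limsup_of_frequently_le (Filter.Eventually.of_forall ha).frequently
    (isBoundedUnder_le_of_forall_le hb)

theorem inv_le_essInf_div_essSup [NeZero ν] (ha : ∀ t, 1 ≤ h t) (hb : ∀ t, h t ≤ b) :
    b⁻¹ ≤ essInf h ν / essSup h ν := by
  have h1 := le_essInf_of_forall_le (ν := ν) ha hb
  have h2 := essSup_le_of_forall_le (ν := ν) ha hb
  have h3 := le_essSup_of_forall_le (ν := ν) ha hb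
  rw [inv_eq_one_div]
  exact div_le_div₀ (by linarith) h1 (by linarith) h2

theorem essInf_div_essSup_eq_inv (ha : ∀ t, 1 ≤ h t) (hb : ∀ t, h t ≤ b)
    (hfa : ν {t | h t = 1} ≠ 0) (hfb : ν {t | h t = b} ≠ 0) :
    essInf h ν / essSup h ν = b⁻¹ := by
  have : NeZero ν := ⟨fun h0 => hfa (by simp [h0])⟩
  have h1 : essInf h ν = 1 := le_antisymm
    (Filter.liminf_le_of_frequently_le
      ((frequently_ae_iff.2 hfa).mono fun t ht => ht.le) (isBoundedUnder_ge_of_forall_le ha))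
    (le_essInf_of_forall_le ha hb)
  have h2 : essSup h ν = b := le_antisymm (essSup_le_of_forall_le ha hb)
    (Filter.le_limsup_of_frequently_le
      ((frequently_ae_iff.2 hfb).mono fun t ht => ht.ge) (isBoundedUnder_le_of_forall_le hb))
  rw [h1, h2, one_div]

end EssBounds

theorem circQuot_Atau {M : ℝ} (hM : 0 < M) (τ : ℝ) (x : V2) {ρ : ℝ} (hρ : 0 < ρ) :
    circQuot (Atau M τ) x ρ =
      ((1 / (2 * π)) * ∫ t in Ioc 0 (2 * π), coneProfile (M ^ τ) (cM M τ) (x + ρ • eit t) t) /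
      ((4 / π) * arctan
        ((essInf (fun t => (Atau M τ (x + ρ • eit t)).det) (volume.restrict (Ioc 0 (2 * π))) /
          essSup (fun t => (Atau M τ (x + ρ • eit t)).det)
            (volume.restrict (Ioc 0 (2 * π)))) ^ ((1 : ℝ) / 4))) := by
  unfold circQuot
  simp only [quad_Atau_div_sqrt_det hM]
  rw [intervalIntegral.integral_mul_const, intervalIntegral.integral_of_le (by positivity)]
  congr 1
  field_simp

theorem cM_eq {M : ℝ} (hM : 0 < M) (τ : ℝ) : cM M τ = 2 / (1 + (M ^ τ)⁻¹) := by
  rw [cM, Real.rpow_neg hM.le]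

theorem inv_rpow_quarter {M : ℝ} (hM : 0 < M) (τ : ℝ) :
    ((M ^ (2 - 2 * τ))⁻¹) ^ ((1 : ℝ) / 4) = M ^ (-(1 - τ) / 2) := by
  rw [← Real.rpow_neg hM.le, ← Real.rpow_mul hM.le]
  congr 1
  ring

theorem one_le_det_Atau {M τ : ℝ} (hM : 1 < M) (hτ : τ ≤ 1) (y : V2) :
    1 ≤ (Atau M τ y).det := by
  rw [det_Atau (by linarith)]
  split_ifs
  · rfl
  · exact Real.one_le_rpow hM.le (by linarith)

theorem det_Atau_le {M τ : ℝ} (hM : 1 < M) (hτ : τ ≤ 1) (y : V2) :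
    (Atau M τ y).det ≤ M ^ (2 - 2 * τ) := by
  rw [det_Atau (by linarith)]
  split_ifs
  · exact Real.one_le_rpow hM.le (by linarith)
  · rfl

theorem neZero_volume_restrict : NeZero ((volume : Measure ℝ).restrict (Ioc 0 (2 * π))) := by
  refine ⟨fun h => ?_⟩
  have := congrArg (fun κ : Measure ℝ => κ univ) h
  simp [Real.pi_pos.not_ge] at this

theorem circQuot_Atau_le {M τ : ℝ} (hM : 1 < M) (hτ : 0 ≤ τ) (hτ' : τ ≤ 1)
    (hL : M ^ τ ≤ 5 / 4) (x : V2) {ρ : ℝ} (hρ : 0 < ρ) :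
    circQuot (Atau M τ) x ρ ≤ cM M τ / ((4 / π) * arctan (M ^ (-(1 - τ) / 2))) := by
  have hM0 : 0 < M := by linarith
  have := neZero_volume_restrict
  have hpos : 0 < M ^ (-(1 - τ) / 2) := Real.rpow_pos_of_pos hM0 _
  have hint := integral_coneProfile_le (x := x) hρ (Real.one_le_rpow hM.le hτ) hL
  rw [← cM_eq hM0] at hint
  rw [circQuot_Atau hM0 τ x hρ]
  refine div_le_div₀ ?_ ?_ ?_ ?_
  · rw [cM_eq hM0]; positivity
  · rw [one_div, inv_mul_le_iff₀ (by positivity)]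
    exact hint
  · have := Real.arctan_pos.2 hpos
    positivity
  · gcongr
    rw [← inv_rpow_quarter hM0]
    exact Real.rpow_le_rpow (by positivity)
      (inv_le_essInf_div_essSup (fun t => one_le_det_Atau hM hτ' _)
        fun t => det_Atau_le hM hτ' _) (by norm_num)

theorem cM_lt_two {M : ℝ} (hM : 0 < M) (τ : ℝ) : cM M τ < 2 := by
  have : 0 < M ^ (-τ) := Real.rpow_pos_of_pos hM _
  rw [cM, div_lt_iff₀ (by positivity)]
  linarith

theorem cM_pos {M : ℝ} (hM : 0 < M) (τ : ℝ) : 0 < cM M τ := by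
  have : 0 < M ^ (-τ) := Real.rpow_pos_of_pos hM _
  unfold cM
  positivity

theorem toComplex_zero : toComplex 0 = 0 := rfl

theorem exp_arg2_circle_zero {ρ : ℝ} (hρ : 0 < ρ) (t : ℝ) :
    Complex.exp (arg2 (0 + ρ • eit t) * Complex.I) = Complex.exp (t * Complex.I) := by
  have h := norm_mul_exp_arg2 (0 + ρ • eit t)
  have hρ' : (ρ : ℂ) ≠ 0 := by exact_mod_cast hρ.ne'
  rw [toComplex_add_smul_eit, toComplex_zero, zero_add, norm_mul,
    Complex.norm_exp_ofReal_mul_I, mul_one, Complex.norm_real, Real.norm_of_nonneg hρ.le] at h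
  exact mul_left_cancel₀ hρ' h

theorem coneProfile_circle_zero {ρ : ℝ} (hρ : 0 < ρ) (L c t : ℝ) :
    coneProfile L c (0 + ρ • eit t) t = if InCone c (0 + ρ • eit t) then 1 else L := by
  have h := exp_arg2_circle_zero hρ t
  set θ := arg2 (0 + ρ • eit t) with hθ
  have hcos : Real.cos θ = Real.cos t := by
    simpa [Complex.exp_ofReal_mul_I_re] using congrArg Complex.re h
  have hsin : Real.sin θ = Real.sin t := by
    simpa [Complex.exp_ofReal_mul_I_im] using congrArg Complex.im h
  have h1 : Real.cos (t - θ) = 1 := by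
    rw [Real.cos_sub, hcos, hsin]
    linarith [Real.sin_sq_add_cos_sq t]
  have h2 : Real.sin (t - θ) = 0 := by
    rw [Real.sin_sub, hcos, hsin]
    ring
  unfold coneProfile
  rw [← hθ, h1, h2]
  simp

theorem circQuot_Atau_zero {M τ : ℝ} (hM : 1 < M) (hτ : τ ≤ 1) {ρ : ℝ} (hρ : 0 < ρ) :
    circQuot (Atau M τ) 0 ρ = cM M τ / ((4 / π) * arctan (M ^ (-(1 - τ) / 2))) := by
  have hM0 : 0 < M := by linarith
  have hc2 := cM_lt_two hM0 τ
  have hc0 := cM_pos hM0 τ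
  have hp := Real.pi_pos
  have hρ0 : ‖toComplex 0‖ < ρ := by simpa [toComplex_zero] using hρ
  have hms := measurableSet_inCone_circle (cM M τ) 0 ρ
  have hvol := volume_inCone_circle hρ0 hc0.le hc2
  have hratio : essInf (fun t => (Atau M τ (0 + ρ • eit t)).det)
        (volume.restrict (Ioc 0 (2 * π))) /
      essSup (fun t => (Atau M τ (0 + ρ • eit t)).det)
        (volume.restrict (Ioc 0 (2 * π))) = (M ^ (2 - 2 * τ))⁻¹ := by
    refine essInf_div_essSup_eq_inv (fun t => one_le_det_Atau hM hτ _)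
      (fun t => det_Atau_le hM hτ _) ?_ ?_
    · refine ne_of_gt (lt_of_lt_of_le ?_ (measure_mono
        (s := {t | InCone (cM M τ) (0 + ρ • eit t)}) fun t ht => ?_))
      · refine pos_iff_ne_zero.2 fun h0 => ?_
        rw [Measure.real, h0] at hvol
        simp only [ENNReal.toReal_zero] at hvol
        nlinarith
      · have ht : InCone (cM M τ) (0 + ρ • eit t) := ht
        simp only [mem_ofPred_eq, det_Atau hM0, if_pos ht]
    · refine ne_of_gt (lt_of_lt_of_le ?_ (measure_mono
        (s := {t | InCone (cM M τ) (0 + ρ • eit t)}ᶜ) fun t ht => ?_))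
      · refine pos_iff_ne_zero.2 fun h0 => ?_
        have h := measureReal_compl (μ := volume.restrict (Ioc 0 (2 * π))) hms
        rw [hvol, Measure.real, h0] at h
        simp [hp.le] at h
        nlinarith
      · have ht : ¬InCone (cM M τ) (0 + ρ • eit t) := ht
        simp only [mem_ofPred_eq, det_Atau hM0, if_neg ht]
  rw [circQuot_Atau hM0 τ 0 hρ, hratio, inv_rpow_quarter hM0]
  simp only [coneProfile_circle_zero hρ]
  rw [(integral_ite_inCone_circle hρ0 hc0.le hc2 _).2, cM_eq hM0]
  have hL : 0 < M ^ τ := Real.rpow_pos_of_pos hM0 _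
  congr 1
  field_simp
  ring

/-- There exists `m₀ > 1` such that, for the coefficient matrix `A_τ` on
the unit disk, `β(A_τ) = (2/π)(1 + M^{−τ}) arctan M^{−(1−τ)/2}` for all
`M ∈ (1, m₀^{1/τ})` if `τ > 0`, and with no restriction on `M > 1` if `τ = 0`. -/
theorem stmt14 :
    ∃ m₀ > (1 : ℝ), ∀ M τ : ℝ, 1 < M → 0 ≤ τ → τ ≤ 1 →
      (τ = 0 ∨ M < m₀ ^ (1 / τ)) →
      betaA (Metric.ball (0 : V2) 1) (Atau M τ) =
        (2 / π) * (1 + M ^ (-τ)) * arctan (M ^ (-(1 - τ) / 2)) := by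
  refine ⟨5 / 4, by norm_num, fun M τ hM hτ hτ' h => ?_⟩
  have hM0 : 0 < M := by linarith
  have hL : M ^ τ ≤ 5 / 4 := by
    rcases hτ.eq_or_lt with rfl | hpos
    · norm_num
    · have h := h.resolve_left hpos.ne'
      calc M ^ τ ≤ ((5 / 4 : ℝ) ^ (1 / τ)) ^ τ := Real.rpow_le_rpow hM0.le h.le hτ
        _ = 5 / 4 := by
          rw [← Real.rpow_mul (by norm_num), one_div_mul_cancel hpos.ne', Real.rpow_one]
  have hdist : 1 / 2 < Metric.infDist (0 : V2) (Metric.ball (0 : V2) 1)ᶜ := by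
    have hne : ((Metric.ball (0 : V2) 1)ᶜ).Nonempty :=
      ⟨EuclideanSpace.single 0 1, by simp⟩
    refine lt_of_lt_of_le (by norm_num : (1 / 2 : ℝ) < 1) ((Metric.le_infDist hne).2 ?_)
    intro y hy
    simpa [dist_comm] using hy
  have hgreatest : IsGreatest {r : ℝ | ∃ x ∈ Metric.ball (0 : V2) 1, ∃ ρ : ℝ, 0 < ρ ∧
      ρ < Metric.infDist x (Metric.ball (0 : V2) 1)ᶜ ∧ r = circQuot (Atau M τ) x ρ}
      (cM M τ / ((4 / π) * arctan (M ^ (-(1 - τ) / 2)))) := by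
    refine ⟨⟨0, by simp, 1 / 2, by norm_num, hdist, ?_⟩, ?_⟩
    · rw [circQuot_Atau_zero hM hτ' (by norm_num)]
    · rintro r ⟨x, -, ρ, hρ, -, rfl⟩
      exact circQuot_Atau_le hM hτ hτ' hL x hρ
  have hpos : 0 < M ^ (-τ) := Real.rpow_pos_of_pos hM0 _
  rw [betaA, hgreatest.csSup_eq, inv_div, cM]
  field_simp
  ring
end
end

section
/- Fix M > 1 and τ ∈ [0,1]; let c = 2/(1 + M^{−τ}) and μ = (4/π) arctan M^{−(1−τ)/2}. Let k_{τ,1}, k_{τ,2} : ℝ → ℝ be the 2π-periodic functions with k_{τ,1}(θ) = 1, k_{τ,2}(θ) = 1 for θ ∈ [0, cπ/2) ∪ [π, π + cπ/2) and k_{τ,1}(θ) = M, k_{τ,2}(θ) = M^{1−2τ} otherwise (θ ∈ [0, 2π)). Define w_τ : [0, π) → ℝ by w_τ(θ) = sin( μ(θ/c − π/4) ) for θ ∈ [0, cπ/2) and w_τ(θ) = M^{−(1−τ)/2} cos( μ( M^{τ}(θ − cπ/2)/c − π/4 ) ) for θ ∈ [cπ/2, π), extended to ℝ by w_τ(θ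 + π) = −w_τ(θ). Then w_τ is a 2π-periodic, locally absolutely continuous weak solution of −(k_{τ,2} w')' = (μ/c)² k_{τ,1} w on ℝ, i.e. ∫₀^{2π} k_{τ,2} w_τ' ψ' = (μ/c)² ∫₀^{2π} k_{τ,1} w_τ ψ for every smooth 2π-periodic ψ. -/
open MeasureTheory Real Set Matrix intervalIntegral
open scoped Classical

noncomputable section

/-- `μ = (4/π) arctan M^{−(1−τ)/2}`. -/
def muM (M τ : ℝ) : ℝ := (4 / π) * arctan (M ^ (-(1 - τ) / 2))

/-- The profile `w_τ` on `[0, π)`. -/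
def wbase (M τ : ℝ) (θ : ℝ) : ℝ :=
  if θ < cM M τ * π / 2 then Real.sin (muM M τ * (θ / cM M τ - π / 4))
  else M ^ (-(1 - τ) / 2) *
    Real.cos (muM M τ * (M ^ τ * (θ - cM M τ * π / 2) / cM M τ - π / 4))

/-- The function `w_τ` on `ℝ`, extended from `[0, π)` by `w_τ(θ + π) = −w_τ(θ)`. -/
def wtau (M τ : ℝ) (θ : ℝ) : ℝ :=
  (-1 : ℝ) ^ ⌊θ / π⌋ * wbase M τ (θ - π * ⌊θ / π⌋)

/-- The `2π`-periodic step weight `k_{τ,1}`. -/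
def ktau1 (M τ : ℝ) (θ : ℝ) : ℝ :=
  if θ - 2 * π * ⌊θ / (2 * π)⌋ ∈ Ico 0 (cM M τ * π / 2) ∪ Ico π (π + cM M τ * π / 2) then 1
  else M

/-- The `2π`-periodic step weight `k_{τ,2}`. -/
def ktau2 (M τ : ℝ) (θ : ℝ) : ℝ :=
  if θ - 2 * π * ⌊θ / (2 * π)⌋ ∈ Ico 0 (cM M τ * π / 2) ∪ Ico π (π + cM M τ * π / 2) then 1
  else M ^ (1 - 2 * τ)

/-- The `π`-antiperiodic extension to `ℝ` of the function on `[0, π)` equal to `f` on `[0, a)` and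
to `g` on `[a, π)`. -/
def antiext (a : ℝ) (f g : ℝ → ℝ) (θ : ℝ) : ℝ :=
  (-1 : ℝ) ^ ⌊θ / π⌋ *
    (if θ - π * ⌊θ / π⌋ < a then f (θ - π * ⌊θ / π⌋) else g (θ - π * ⌊θ / π⌋))

lemma antiext_add_int_mul (a : ℝ) (f g : ℝ → ℝ) (θ : ℝ) (n : ℤ) :
    antiext a f g (θ + n * π) = (-1 : ℝ) ^ n * antiext a f g θ := by
  have h : ⌊(θ + n * π) / π⌋ = ⌊θ / π⌋ + n := by
    rw [add_div, mul_div_cancel_right₀ _ pi_ne_zero, Int.floor_add_intCast]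
  have h2 : θ + n * π - π * ((⌊θ / π⌋ + n : ℤ) : ℝ) = θ - π * ⌊θ / π⌋ := by
    push_cast; ring
  unfold antiext
  rw [h, h2, zpow_add₀ (by norm_num)]
  ring

lemma antiext_periodic (a : ℝ) (f g : ℝ → ℝ) : Function.Periodic (antiext a f g) (2 * π) := by
  intro θ
  simpa using antiext_add_int_mul a f g θ 2

lemma antiext_of_mem_Ico (a : ℝ) (f g : ℝ → ℝ) {θ : ℝ} (h : θ ∈ Ico 0 π) :
    antiext a f g θ = if θ < a then f θ else g θ := by
  have h0 : ⌊θ / π⌋ = 0 := by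
    rw [Int.floor_eq_zero_iff]
    exact ⟨div_nonneg h.1 pi_pos.le, (div_lt_one pi_pos).2 h.2⟩
  simp [antiext, h0]

lemma exists_mem_Ico_add_int_mul_pi (x : ℝ) : ∃ y ∈ Ico 0 π, ∃ n : ℤ, x = y + n * π :=
  ⟨toIcoMod pi_pos 0 x, by simpa using toIcoMod_mem_Ico pi_pos 0 x, toIcoDiv pi_pos 0 x, by
    simp⟩

lemma exists_mem_Ioc_add_int_mul_pi (x : ℝ) : ∃ y ∈ Ioc 0 π, ∃ n : ℤ, x = y + n * π :=
  ⟨toIocMod pi_pos 0 x, by simpa using toIocMod_mem_Ioc pi_pos 0 x, toIocDiv pi_pos 0 x, by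
    simp⟩

lemma antiext_eq_comp_sub (a : ℝ) (f g : ℝ → ℝ) (n : ℤ) :
    antiext a f g = fun θ => (-1 : ℝ) ^ n * antiext a f g (θ - n * π) := by
  funext θ
  rw [← antiext_add_int_mul, sub_add_cancel]

lemma hasDerivWithinAt_antiext {a : ℝ} {f g f' g' : ℝ → ℝ} (hf : ∀ x, HasDerivAt f (f' x) x)
    (hg : ∀ x, HasDerivAt g (g' x) x) (x : ℝ) :
    HasDerivWithinAt (antiext a f g) (antiext a f' g' x) (Ioi x) x := by
  obtain ⟨y, hy, n, rfl⟩ := exists_mem_Ico_add_int_mul_pi x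
  have key : HasDerivWithinAt (antiext a f g) (antiext a f' g' y) (Ioi y) y := by
    rw [antiext_of_mem_Ico a f' g' hy]
    split_ifs with h
    · refine (hf y).hasDerivWithinAt.congr_of_eventuallyEq ?_ ?_
      · filter_upwards [Ioo_mem_nhdsGT (lt_min h hy.2)] with z hz
        have h1 := lt_min_iff.1 hz.2
        rw [antiext_of_mem_Ico a f g ⟨hy.1.trans hz.1.le, h1.2⟩, if_pos h1.1]
      · rw [antiext_of_mem_Ico a f g hy, if_pos h]
    · refine (hg y).hasDerivWithinAt.congr_of_eventuallyEq ?_ ?_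
      · filter_upwards [Ioo_mem_nhdsGT hy.2] with z hz
        rw [antiext_of_mem_Ico a f g ⟨hy.1.trans hz.1.le, hz.2⟩,
          if_neg (by linarith [hz.1, not_lt.1 h])]
      · rw [antiext_of_mem_Ico a f g hy, if_neg h]
  rw [antiext_eq_comp_sub a f g n, antiext_add_int_mul]
  refine HasDerivWithinAt.const_mul _ ?_
  have hs : HasDerivWithinAt (fun θ : ℝ => θ - n * π) 1 (Ioi (y + n * π)) (y + n * π) :=
    ((hasDerivAt_id _).sub_const _).hasDerivWithinAt
  have := HasDerivWithinAt.comp (h₂ := antiext a f g) (h₂' := antiext a f' g' y) (s' := Ioi y)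
    (y + n * π) (by simpa using key) hs (fun z hz => by
      simp only [mem_Ioi] at hz ⊢; linarith)
  simpa [Function.comp_def] using this

lemma continuous_antiext {a : ℝ} {f g : ℝ → ℝ} (ha : 0 < a) (haπ : a < π) (hf : Differentiable ℝ f)
    (hg : Differentiable ℝ g) (h_mid : f a = g a) (h_end : g π = -f 0) :
    Continuous (antiext a f g) := by
  rw [continuous_iff_continuousAt]
  intro x
  rw [continuousAt_iff_continuous_left'_right']
  refine ⟨?_, (hasDerivWithinAt_antiext (fun x => (hf x).hasDerivAt)
    (fun x => (hg x).hasDerivAt) x).continuousWithinAt⟩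
  obtain ⟨y, hy, n, rfl⟩ := exists_mem_Ioc_add_int_mul_pi x
  have key : ContinuousWithinAt (antiext a f g) (Iio y) y := by
    rcases le_or_gt y a with h | h
    · refine (hf y).continuousAt.continuousWithinAt.congr_of_eventuallyEq ?_ ?_
      · filter_upwards [Ioo_mem_nhdsLT hy.1] with z hz
        rw [antiext_of_mem_Ico a f g ⟨hz.1.le, hz.2.trans_le hy.2⟩, if_pos (hz.2.trans_le h)]
      · rw [antiext_of_mem_Ico a f g ⟨hy.1.le, h.trans_lt haπ⟩]
        split_ifs with h'
        · rfl
        · rw [le_antisymm h (not_lt.1 h'), h_mid]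
    · refine (hg y).continuousAt.continuousWithinAt.congr_of_eventuallyEq ?_ ?_
      · filter_upwards [Ioo_mem_nhdsLT h] with z hz
        rw [antiext_of_mem_Ico a f g ⟨(ha.trans hz.1).le, hz.2.trans_le hy.2⟩,
          if_neg hz.1.le.not_gt]
      · rcases hy.2.lt_or_eq with h' | rfl
        · rw [antiext_of_mem_Ico a f g ⟨hy.1.le, h'⟩, if_neg h.le.not_gt]
        · have := antiext_add_int_mul a f g 0 1
          rw [antiext_of_mem_Ico a f g ⟨le_rfl, pi_pos⟩, if_pos ha] at this
          simpa [h_end] using this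
  rw [antiext_eq_comp_sub a f g n]
  refine ContinuousWithinAt.const_mul ?_ _
  refine ContinuousWithinAt.comp (g := antiext a f g) (f := fun θ => θ - n * π) (t := Iio y)
    (by simpa using key) (by fun_prop) (fun z hz => ?_)
  simp only [mem_Iio] at hz ⊢
  linarith

lemma locallyIntegrable_antiext (a : ℝ) {f g : ℝ → ℝ} (hf : Continuous f) (hg : Continuous g) :
    LocallyIntegrable (antiext a f g) := by
  obtain ⟨C, hC⟩ := (isCompact_Icc (a := 0) (b := π)).exists_bound_of_continuousOn hf.continuousOn
  obtain ⟨D, hD⟩ := (isCompact_Icc (a := 0) (b := π)).exists_bound_of_continuousOn hg.continuousOn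
  have hmeas : Measurable (antiext a f g) := by
    have hfl : Measurable fun θ : ℝ => ⌊θ / π⌋ := Int.measurable_floor.comp (by fun_prop)
    have hr : Measurable fun θ : ℝ => θ - π * ⌊θ / π⌋ := by
      have : Measurable fun θ : ℝ => ((⌊θ / π⌋ : ℤ) : ℝ) := measurable_from_top.comp hfl
      fun_prop
    have hs : Measurable fun θ : ℝ => (-1 : ℝ) ^ ⌊θ / π⌋ :=
      (measurable_from_top (f := fun n : ℤ => (-1 : ℝ) ^ n)).comp hfl
    exact hs.mul (Measurable.ite (measurableSet_lt hr measurable_const)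
      (hf.measurable.comp hr) (hg.measurable.comp hr))
  refine (locallyIntegrable_const (max C D)).mono hmeas.aestronglyMeasurable
    (Filter.Eventually.of_forall fun x => ?_)
  obtain ⟨y, hy, n, rfl⟩ := exists_mem_Ico_add_int_mul_pi x
  rw [antiext_add_int_mul, antiext_of_mem_Ico a f g hy, norm_mul, norm_zpow]
  simp only [norm_neg, norm_one, _root_.one_zpow, one_mul]
  refine le_trans ?_ (le_abs_self _)
  have hy' := Ico_subset_Icc_self hy
  split_ifs
  · exact (hC y hy').trans (le_max_left _ _)
  · exact (hD y hy').trans (le_max_right _ _)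

lemma antiext_mul_periodic_eq {a p : ℝ} {f g : ℝ → ℝ} (haπ : a < π) {θ : ℝ}
    (hθ : θ ∈ Ico 0 (2 * π)) :
    (if θ - 2 * π * ⌊θ / (2 * π)⌋ ∈ Ico 0 a ∪ Ico π (π + a) then 1 else p) * antiext a f g θ =
      antiext a f (fun x => p * g x) θ := by
  have h0 : ⌊θ / (2 * π)⌋ = 0 := by
    rw [Int.floor_eq_zero_iff]
    exact ⟨div_nonneg hθ.1 two_pi_pos.le, (div_lt_one two_pi_pos).2 hθ.2⟩
  rw [h0]
  simp only [Int.cast_zero, mul_zero, sub_zero, mem_union, mem_Ico]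
  rcases lt_or_ge θ π with h | h
  · rw [antiext_of_mem_Ico a f _ ⟨hθ.1, h⟩, antiext_of_mem_Ico a f _ ⟨hθ.1, h⟩]
    simp [hθ.1, h.not_ge]
    split_ifs <;> simp
  · have hm : θ - π ∈ Ico 0 π := ⟨by linarith, by linarith [hθ.2]⟩
    have e : ∀ u v : ℝ → ℝ, antiext a u v θ = -antiext a u v (θ - π) := fun u v => by
      simpa using antiext_add_int_mul a u v (θ - π) 1
    have hc : ((0 ≤ θ ∧ θ < a) ∨ (π ≤ θ ∧ θ < π + a)) ↔ θ - π < a :=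
      ⟨by rintro (h' | h') <;> linarith [h'.2], fun h' => Or.inr ⟨h, by linarith⟩⟩
    rw [e, e, antiext_of_mem_Ico a f _ hm, antiext_of_mem_Ico a f _ hm]
    simp only [hc]
    split_ifs <;> simp

lemma integral_antiext_mul_deriv {a : ℝ} {f g f' g' ψ : ℝ → ℝ} (ha : 0 < a) (haπ : a < π)
    (hf : ∀ x, HasDerivAt f (f' x) x) (hg : ∀ x, HasDerivAt g (g' x) x)
    (hf' : Continuous f') (hg' : Continuous g') (h_mid : f a = g a) (h_end : g π = -f 0)
    (hψ : ContDiff ℝ 1 ψ) (hper : Function.Periodic ψ (2 * π)) :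
    ∫ t in (0 : ℝ)..(2 * π), antiext a f g t * deriv ψ t =
      -∫ t in (0 : ℝ)..(2 * π), antiext a f' g' t * ψ t := by
  have hc := continuous_antiext ha haπ (fun x => (hf x).differentiableAt)
    (fun x => (hg x).differentiableAt) h_mid h_end
  have hψ' : Continuous (deriv ψ) := hψ.continuous_deriv le_rfl
  have hi1 : IntervalIntegrable (fun t => antiext a f' g' t * ψ t) volume 0 (2 * π) :=
    (IntegrableOn.intervalIntegrable
      ((locallyIntegrable_antiext a hf' hg').integrableOn_isCompact isCompact_uIcc)).mul_continuousOn
      hψ.continuous.continuousOn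
  have hi2 : IntervalIntegrable (fun t => antiext a f g t * deriv ψ t) volume 0 (2 * π) :=
    (hc.mul hψ').intervalIntegrable _ _
  have h := integral_eq_sub_of_hasDeriv_right (hc.mul hψ.continuous).continuousOn
    (fun x _ => (hasDerivWithinAt_antiext (a := a) hf hg x).mul
      ((hψ.differentiable one_ne_zero x).hasDerivAt.hasDerivWithinAt)) (hi1.add hi2)
  rw [integral_add hi1 hi2] at h
  have p1 := antiext_periodic a f g 0
  have p2 := hper 0
  rw [zero_add] at p1 p2
  simp only [Pi.mul_apply, p1, p2, sub_self] at h
  linarith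

lemma integral_congr_of_eqOn_Ico {f g : ℝ → ℝ} {a b : ℝ} (hab : a ≤ b) (h : EqOn f g (Ico a b)) :
    ∫ t in a..b, f t = ∫ t in a..b, g t := by
  rw [integral_of_le hab, integral_of_le hab, ← integral_Ico_eq_integral_Ioc,
    ← integral_Ico_eq_integral_Ioc]
  exact setIntegral_congr_fun measurableSet_Ico h

/-- The function `w_τ` is `2π`-periodic, locally absolutely continuous,
and a weak solution of `−(k_{τ,2} w')' = (μ/c)² k_{τ,1} w` on `ℝ`:
`∫₀^{2π} k_{τ,2} w_τ' ψ' = (μ/c)² ∫₀^{2π} k_{τ,1} w_τ ψ` for every smooth `2π`-periodic `ψ`. -/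
theorem stmt15 (M τ : ℝ) (hM : 1 < M) (hτ0 : 0 ≤ τ) (hτ1 : τ ≤ 1) :
    Function.Periodic (wtau M τ) (2 * π) ∧
      ∃ w' : ℝ → ℝ, LocallyIntegrable w' ∧
        (∀ s t : ℝ, wtau M τ t = wtau M τ s + ∫ r in s..t, w' r) ∧
        ∀ ψ : ℝ → ℝ, ContDiff ℝ (⊤ : ℕ∞) ψ → Function.Periodic ψ (2 * π) →
          (∫ t in (0 : ℝ)..(2 * π), ktau2 M τ t * w' t * deriv ψ t) =
            (muM M τ / cM M τ) ^ 2 * ∫ t in (0 : ℝ)..(2 * π), ktau1 M τ t * wtau M τ t * ψ t := by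
  have hM0 : 0 < M := by linarith
  set c := cM M τ with hc
  set m := muM M τ with hm
  set A := M ^ (-(1 - τ) / 2) with hA
  have hq0 : 0 < M ^ (-τ) := rpow_pos_of_pos hM0 _
  have hqQ : M ^ (-τ) * M ^ τ = 1 := by rw [← rpow_add hM0]; simp
  have hc_eq : c * (1 + M ^ (-τ)) = 2 := by
    rw [hc, cM]; field_simp
  have hc0 : 0 < c := by rw [hc, cM]; positivity
  have hc2 : c < 2 := by nlinarith
  have ha : 0 < c * π / 2 := by positivity
  have haπ : c * π / 2 < π := by nlinarith [pi_pos]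
  have hs_end : M ^ τ * (π - c * π / 2) / c - π / 4 = π / 4 := by
    have : M ^ τ * (2 - c) = c := by linear_combination (-M ^ τ) * hc_eq + c * hqQ
    have h2 : M ^ τ * (π - c * π / 2) / c = π / 2 := by
      rw [div_eq_iff hc0.ne']; linear_combination π / 2 * this
    rw [h2]; ring
  have hsin : sin (m * (π / 4)) = A * cos (m * (π / 4)) := by
    have e : m * (π / 4) = arctan A := by
      rw [hm, muM, ← hA, mul_right_comm, div_mul_div_cancel₀ pi_ne_zero, div_self four_ne_zero,
        one_mul]
    rw [e, ← tan_mul_cos (cos_arctan_pos A).ne', tan_arctan]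
  have hpow : M ^ (1 - 2 * τ) * M ^ τ * (A * A) = 1 := by
    rw [hA, ← rpow_add hM0, ← rpow_add hM0, ← rpow_add hM0, ← rpow_zero M]
    congr 1; ring
  have hpow2 : M ^ (1 - 2 * τ) * (M ^ τ * M ^ τ) = M := by
    rw [← rpow_add hM0, ← rpow_add hM0]
    ring_nf; exact rpow_one M
  set P := M ^ (1 - 2 * τ) with hP
  set Q := M ^ τ with hQ
  have d1 : ∀ x, HasDerivAt (fun θ : ℝ => m * (θ / c - π / 4)) (m / c) x := fun x => by
    simpa [mul_div_assoc, div_eq_mul_inv] using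
      (((hasDerivAt_id x).div_const c).sub_const (π / 4)).const_mul m
  have d2 : ∀ x, HasDerivAt (fun θ : ℝ => m * (Q * (θ - c * π / 2) / c - π / 4))
      (m / c * Q) x := fun x => by
    refine ((((((hasDerivAt_id x).sub_const (c * π / 2)).const_mul Q).div_const c).sub_const
      (π / 4)).const_mul m).congr_deriv ?_
    ring
  have hw : wtau M τ = antiext (c * π / 2) (fun θ => sin (m * (θ / c - π / 4)))
      (fun θ => A * cos (m * (Q * (θ - c * π / 2) / c - π / 4))) := rfl
  have dw1 : ∀ x, HasDerivAt (fun θ : ℝ => sin (m * (θ / c - π / 4)))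
      (cos (m * (x / c - π / 4)) * (m / c)) x := fun x => (d1 x).sin
  have dw2 : ∀ x, HasDerivAt (fun θ : ℝ => A * cos (m * (Q * (θ - c * π / 2) / c - π / 4)))
      (A * (-sin (m * (Q * (x - c * π / 2) / c - π / 4)) * (m / c * Q))) x :=
    fun x => (d2 x).cos.const_mul A
  have hmid : (c * π / 2) / c - π / 4 = π / 4 := by field_simp; ring
  have hdw : LocallyIntegrable (antiext (c * π / 2) (fun x => cos (m * (x / c - π / 4)) * (m / c))
      (fun x => A * (-sin (m * (Q * (x - c * π / 2) / c - π / 4)) * (m / c * Q)))) :=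
    locallyIntegrable_antiext _ (by fun_prop) (by fun_prop)
  have hwc : Continuous (wtau M τ) := by
    rw [hw]
    refine continuous_antiext ha haπ (fun x => (dw1 x).differentiableAt)
      (fun x => (dw2 x).differentiableAt) ?_ ?_
    · simp [hmid, hsin]
    · simp [hs_end, hsin]
  refine ⟨hw ▸ antiext_periodic _ _ _, _, hdw, fun s t => ?_, fun ψ hψ hper => ?_⟩
  · rw [integral_eq_sub_of_hasDeriv_right hwc.continuousOn
      (fun x _ => by rw [hw]; exact hasDerivWithinAt_antiext dw1 dw2 x) (hdw.integrableOn_isCompact isCompact_uIcc).intervalIntegrable]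
    ring
  · have key := integral_antiext_mul_deriv (ψ := ψ) ha haπ
      (fun x => (d1 x).cos.mul_const (m / c))
      (fun x => (((d2 x).sin.neg.mul_const (m / c * Q)).const_mul A).const_mul P)
      (by fun_prop) (by fun_prop)
      (by
        simp only [Pi.neg_apply, hmid, sub_self, mul_zero, zero_div, zero_sub, mul_neg, sin_neg,
          neg_neg, hsin]
        linear_combination (-cos (m * (π / 4)) * (m / c)) * hpow)
      (by
        simp only [Pi.neg_apply, hs_end, zero_div, zero_sub, mul_neg, cos_neg, hsin]
        linear_combination (-cos (m * (π / 4)) * (m / c)) * hpow)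
      (hψ.of_le (by exact_mod_cast le_top)) hper
    rw [integral_congr_of_eqOn_Ico two_pi_pos.le fun t ht => ?_, key,
      ← intervalIntegral.integral_neg, ← intervalIntegral.integral_const_mul]
    · refine integral_congr_of_eqOn_Ico two_pi_pos.le fun t ht => ?_
      have := antiext_mul_periodic_eq (p := M)
        (f := fun θ => sin (m * (θ / c - π / 4)))
        (g := fun θ => A * cos (m * (Q * (θ - c * π / 2) / c - π / 4))) haπ ht
      simp only [hw, ktau1]
      rw [this]
      simp only [antiext]
      split_ifs
      · ring
      · rw [← hpow2]
        ring
    · have := antiext_mul_periodic_eq (p := P)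
        (f := fun x => cos (m * (x / c - π / 4)) * (m / c))
        (g := fun x => A * (-sin (m * (Q * (x - c * π / 2) / c - π / 4)) * (m / c * Q))) haπ ht
      simp only [ktau2]
      rw [this]
      rfl
end
end
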